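/- Let p be a prime with p ≡ 1 (mod 4), n ≥ 2 an integer with p > (4n+1)², and A an integer with 0 < |A| < p/2 and A ≠ ±1. Then the map f(x) = (A x^{(p+1)/2} mod p) on I is not of Type (iii): there are no indices i, j with 0 ≤ i, j ≤ n−1 and f(I_i) ⊆ I_j. -/

import Mathlib

/-- `Iclass p n j` is the residue class `I_j = {x : 1 ≤ x ≤ p-1, x ≡ j (mod n)}`. -/
def Iclass (p n j : ℕ) : Finset ℕ :=
  (Finset.Icc 1 (p - 1)).filter fun x => x % n = j

/-- `fmap p A k x` is `A x^k mod p`, the least residue in `{0, …, p-1}`. -/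
def fmap (p : ℕ) (A : ℤ) (k : ℕ) (x : ℕ) : ℕ :=
  ((A : ZMod p) * (x : ZMod p) ^ k).val

/-- On the class `x ≡ i (mod n)` in `(0, p)`, the residue mod `n` of `⌊A x / p⌋` depends only on
the quadratic character of `x`. -/
def FloorCompat (p : ℕ) [Fact p.Prime] (n A i : ℤ) : Prop :=
  ∀ x x' s s' : ℤ, 0 < x → x < p → n ∣ x - i → 0 < x' → x' < p → n ∣ x' - i →
    s * p < A * x → A * x < (s + 1) * p → s' * p < A * x' → A * x' < (s' + 1) * p →
    legendreSym p x = legendreSym p x' → n ∣ s - s'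

section

variable {p : ℕ} [Fact p.Prime] {n A i : ℤ}

theorem FloorCompat.neg (h : FloorCompat p n A i) : FloorCompat p n (-A) i := by
  intro x x' s s' h1 h2 h3 h4 h5 h6 h7 h8 h9 h10 h11
  have := h x' x (-1 - s') (-1 - s) h4 h5 h6 h1 h2 h3 (by linarith) (by linarith) (by linarith)
    (by linarith) h11.symm
  have e : -1 - s' - (-1 - s) = s - s' := by ring
  rwa [e] at this

theorem legendreSym_eq_or {x : ℤ} (h0 : 0 < x) (h1 : x < p) :
    legendreSym p x = 1 ∨ legendreSym p x = -1 := by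
  apply legendreSym.eq_one_or_neg_one
  rw [Ne, ZMod.intCast_zmod_eq_zero_iff_dvd]
  exact fun h => absurd (Int.le_of_dvd h0 h) (by lia)

theorem not_dvd_mul_of_lt {a b : ℤ} (ha0 : 0 < a) (ha : a < p) (hb0 : 0 < b) (hb : b < p) :
    ¬ (p : ℤ) ∣ a * b := by
  intro h
  rcases (Nat.prime_iff_prime_int.mp (Fact.out : p.Prime)).dvd_or_dvd h with h | h
  · exact absurd (Int.le_of_dvd ha0 h) (by lia)
  · exact absurd (Int.le_of_dvd hb0 h) (by lia)

theorem exists_strict_floor {a b : ℤ} (ha0 : 0 < a) (ha : a < p) (hb0 : 0 < b) (hb : b < p) :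
    ∃ s : ℤ, s * p < a * b ∧ a * b < (s + 1) * p := by
  have hp : (0 : ℤ) < p := ha0.trans ha
  refine ⟨a * b / p, lt_of_le_of_ne (Int.ediv_mul_le _ hp.ne') fun h => ?_,
    Int.lt_ediv_add_one_mul_self _ hp⟩
  exact not_dvd_mul_of_lt ha0 ha hb0 hb ⟨a * b / p, by rw [mul_comm (p : ℤ), h]⟩

theorem exists_modEq_between {P B c : ℤ} (hn : 0 < n) (hB : 0 < B) (hBn : B * n < P)
    (hc : 0 ≤ c) (i : ℤ) :
    ∃ x : ℤ, 0 < x ∧ n ∣ x - i ∧ c * P < B * x ∧ B * x < (c + 1) * P := by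
  have hP : 0 < P := (mul_pos hB hn).trans hBn
  set u := c * P / B with hu
  have hu0 : 0 ≤ u := Int.ediv_nonneg (by positivity) hB.le
  have h1 : u * B ≤ c * P := Int.ediv_mul_le _ hB.ne'
  have h2 : c * P < (u + 1) * B := Int.lt_ediv_add_one_mul_self _ hB
  have h3 := Int.emod_nonneg (i - u - 1) hn.ne'
  have h4 := Int.emod_lt_of_pos (i - u - 1) hn
  have h5 := Int.emod_add_mul_ediv (i - u - 1) n
  set r := (i - u - 1) % n
  refine ⟨u + 1 + r, by lia, ⟨-((i - u - 1) / n), by linarith⟩, by nlinarith, ?_⟩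
  have : B * (u + 1 + r) ≤ B * (u + n) := mul_le_mul_of_nonneg_left (by lia) hB.le
  linarith

/-- The quadratic character cannot alternate along the progression `x ≡ i (mod n)`. -/
theorem not_alternating (hn : 2 ≤ n) (hpn : (4 * n + 1) ^ 2 < (p : ℤ))
    (h : ∀ x : ℤ, 0 < x → x + n < p → n ∣ x - i → legendreSym p (x + n) = -legendreSym p x) :
    False := by
  have hiter : ∀ (k : ℕ) (x : ℤ), 0 < x → x + k * n < p → n ∣ x - i →
      legendreSym p (x + k * n) = (-1) ^ k * legendreSym p x := by
    intro k
    induction k with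
    | zero => intro x _ _ _; simp
    | succ k ih =>
      intro x h0 h1 h2
      push_cast at h1 ⊢
      have e : x + ((k : ℤ) + 1) * n = x + k * n + n := by ring
      rw [e] at h1 ⊢
      rw [h (x + k * n) (by positivity) h1 (by
        have : x + k * n - i = x - i + k * n := by ring
        rw [this]; exact dvd_add h2 (dvd_mul_left _ _)), ih x h0 (by linarith) h2]
      ring
  obtain ⟨x, hx0, hxi, -, hxn⟩ := exists_modEq_between (P := n + 1) (B := 1) (c := 0)
    (by lia : 0 < n) one_pos (by lia) le_rfl i
  obtain ⟨z, hz0, hzx, hz1, hz2⟩ := exists_modEq_between (n := 2 * n) (P := p) (B := n + 1)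
    (c := n) (by lia) (by lia) (by nlinarith) (by lia) x
  have hzp : z < p := by nlinarith
  have hzi : n ∣ z - i := by
    have := dvd_add ((Dvd.intro_left 2 rfl : n ∣ 2 * n).trans hzx) hxi
    simpa using this
  lift x to ℕ using hx0.le
  have e1 : legendreSym p ((n + 1) * x) = (-1) ^ x * legendreSym p x := by
    rw [← hiter x x hx0 (by nlinarith) hxi]; congr 1; ring
  obtain ⟨k, hk⟩ : ∃ k : ℕ, (k : ℤ) = p - z := ⟨(p - z).toNat, by lia⟩
  have e2 : legendreSym p z = (-1) ^ k * legendreSym p ((n + 1) * z) := by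
    have h0 : 0 < (n + 1) * z - n * p := by linarith
    have hz : (n + 1) * z - n * p + k * n = z := by rw [hk]; ring
    have := hiter k ((n + 1) * z - n * p) h0 (by rw [hz]; exact hzp) (by
      have : (n + 1) * z - n * p - i = z - i + n * (z - p) := by ring
      rw [this]; exact dvd_add hzi (dvd_mul_right _ _))
    rw [hz] at this
    rw [this, legendreSym.mod p ((n + 1) * z - n * p), Int.sub_mul_emod_self_right,
      ← legendreSym.mod]
  have hpar : Odd (k + x) := by
    have hp2 : p ≠ 2 := by rintro rfl; push_cast at hpn; nlinarith
    have := (Fact.out : p.Prime).odd_of_ne_two hp2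
    rw [Nat.odd_iff] at this ⊢
    obtain ⟨m, hm⟩ := hzx
    rw [mul_assoc] at hm
    lia
  rw [legendreSym.mul] at e1 e2
  have hm1 : ((-1 : ℤ) ^ k) * (-1) ^ x = -1 := by rw [← pow_add]; exact hpar.neg_one_pow
  have h3 : legendreSym p z = -legendreSym p z := by
    have e3 : legendreSym p (n + 1) = (-1) ^ x := by
      rcases legendreSym_eq_or hx0 (by nlinarith : (x : ℤ) < p) with h4 | h4 <;>
      rw [h4] at e1 <;> linarith
    rw [e3, ← mul_assoc, hm1] at e2
    linarith
  rcases legendreSym_eq_or hz0 hzp with h4 | h4 <;> rw [h4] at h3 <;> norm_num at h3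

theorem FloorCompat.mul_lt (h : FloorCompat p n A i) (hn : 2 ≤ n)
    (hpn : (4 * n + 1) ^ 2 < (p : ℤ)) (hA0 : 0 < A) (hA : 2 * A < p) : A * n < p := by
  by_contra! hlt
  have hnp : n < p := by nlinarith
  have hlt : p < A * n := lt_of_le_of_ne hlt fun e =>
    not_dvd_mul_of_lt hA0 (by lia) (by lia : 0 < n) hnp ⟨1, by rw [← e]; ring⟩
  refine not_alternating (i := i) hn hpn fun x hx0 hx hxi => ?_
  by_contra hne
  obtain ⟨s, hs1, hs2⟩ := exists_strict_floor hA0 (by lia) hx0 (by lia : x < p)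
  obtain ⟨t, ht1, ht2⟩ := exists_strict_floor hA0 (by lia) (by lia : 0 < x + n) hx
  have heq : legendreSym p (x + n) = legendreSym p x := by
    rcases legendreSym_eq_or hx0 (by lia : x < p) with h1 | h1 <;>
    rcases legendreSym_eq_or (by lia : 0 < x + n) hx with h2 | h2 <;>
    rw [h1, h2] at hne ⊢ <;> norm_num at hne
  have hd := h (x + n) x t s (by lia) hx (by
    have : x + n - i = x - i + n := by ring
    rw [this]; exact dvd_add hxi dvd_rfl) hx0 (by lia) hxi ht1 ht2 hs1 hs2 heq
  have hpos : 0 < t - s := by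
    by_contra! hle
    nlinarith
  have hge := Int.le_of_dvd hpos hd
  nlinarith

theorem FloorCompat.false_of_three_le (h : FloorCompat p n A i) (hn : 3 ≤ n)
    (hpn : (4 * n + 1) ^ 2 < (p : ℤ)) (hA2 : 2 ≤ A) (hA : 2 * A < p) : False := by
  have hAn := h.mul_lt (by lia) hpn (by lia) hA
  have hsep : ∀ x x' s s' : ℤ, 0 < x → x < p → n ∣ x - i → 0 < x' → x' < p → n ∣ x' - i →
      s * p < A * x → A * x < (s + 1) * p → s' * p < A * x' → A * x' < (s' + 1) * p →
      s < s' → s' < s + n → legendreSym p x' = -legendreSym p x := by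
    intro x x' s s' h1 h2 h3 h4 h5 h6 h7 h8 h9 h10 h11 h12
    have hne : legendreSym p x' ≠ legendreSym p x := fun e => by
      have := Int.le_of_dvd (by lia) (h x' x s' s h4 h5 h6 h1 h2 h3 h9 h10 h7 h8 e)
      lia
    rcases legendreSym_eq_or h1 h2 with h13 | h13 <;>
    rcases legendreSym_eq_or h4 h5 with h14 | h14 <;>
    rw [h13, h14] at hne ⊢ <;> lia
  rcases eq_or_lt_of_le hA2 with rfl | hA3
  · obtain ⟨x, hx0, hxi, -, hxn⟩ := exists_modEq_between (P := n + 1) (B := 1) (c := 0)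
      (by lia : 0 < n) one_pos (by lia) le_rfl i
    obtain ⟨z, hz0, hzi, hz1, hz2⟩ := exists_modEq_between (P := p) (B := 2 * (n + 1)) (c := 1)
      (by lia : 0 < n) (by lia) (by nlinarith) (by lia) i
    have hdvd : ∀ w : ℤ, n ∣ w - i → n ∣ (n + 1) * w - i := fun w hw => by
      have : (n + 1) * w - i = w - i + n * w := by ring
      rw [this]; exact dvd_add hw (dvd_mul_right _ _)
    have hx1 : 2 * ((n + 1) * x) < p := by nlinarith
    have hxx : 0 < (n + 1) * x := by positivity
    have hzz : 0 < (n + 1) * z := by positivity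
    have hzs : 2 * z < p := by nlinarith
    have hxs : 2 * x < p := by nlinarith
    have c1 := hsep x ((n + 1) * z) 0 1 hx0 (by lia) hxi hzz (by lia) (hdvd z hzi)
      (by lia) (by lia) (by lia) (by lia) (by lia) (by lia)
    have c2 := hsep ((n + 1) * x) ((n + 1) * z) 0 1 hxx (by lia) (hdvd x hxi) hzz (by lia)
      (hdvd z hzi) (by lia) (by lia) (by lia) (by lia) (by lia) (by lia)
    have c3 := hsep z ((n + 1) * z) 0 1 hz0 (by lia) hzi hzz (by lia) (hdvd z hzi)
      (by lia) (by lia) (by lia) (by lia) (by lia) (by lia)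
    rw [legendreSym.mul] at c1 c2 c3
    rw [legendreSym.mul] at c2
    rcases legendreSym_eq_or hx0 (by lia : x < p) with h1 | h1 <;>
    rcases legendreSym_eq_or hz0 (by lia : z < p) with h2 | h2 <;>
    rw [h1] at c1 c2 <;> rw [h2] at c1 c2 c3 <;> lia
  · have hex : ∀ c : ℤ, 0 ≤ c → c < A → ∃ x : ℤ, 0 < x ∧ x < p ∧ n ∣ x - i ∧
        c * p < A * x ∧ A * x < (c + 1) * p := by
      intro c hc0 hcA
      obtain ⟨x, h1, h2, h3, h4⟩ := exists_modEq_between (P := p) (by lia : 0 < n)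
        (by lia : 0 < A) hAn hc0 i
      refine ⟨x, h1, ?_, h2, h3, h4⟩
      by_contra! hle
      nlinarith
    obtain ⟨x, a1, a2, a3, a4, a5⟩ := hex 0 (by lia) (by lia)
    obtain ⟨y, b1, b2, b3, b4, b5⟩ := hex 1 (by lia) (by lia)
    obtain ⟨z, c1, c2, c3, c4, c5⟩ := hex 2 (by lia) (by lia)
    have e1 := hsep x y 0 1 a1 a2 a3 b1 b2 b3 a4 a5 b4 b5 (by lia) (by lia)
    have e2 := hsep y z 1 2 b1 b2 b3 c1 c2 c3 b4 b5 c4 c5 (by lia) (by lia)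
    have e3 := hsep x z 0 2 a1 a2 a3 c1 c2 c3 a4 a5 c4 c5 (by lia) (by lia)
    rcases legendreSym_eq_or a1 a2 with h1 | h1 <;> lia

/-- For modulus `2`, both parity classes reduce to the statement about `⌊2 A t / p⌋` for
`0 < t < p / 2`. -/
theorem FloorCompat.half (h : FloorCompat p 2 A i) (t t' s s' : ℤ) (ht0 : 0 < t)
    (ht : 2 * t < p) (ht0' : 0 < t') (ht' : 2 * t' < p)
    (h1 : s * p < 2 * A * t) (h2 : 2 * A * t < (s + 1) * p)
    (h3 : s' * p < 2 * A * t') (h4 : 2 * A * t' < (s' + 1) * p)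
    (he : legendreSym p t = legendreSym p t') : 2 ∣ s - s' := by
  rcases Int.even_or_odd' i with ⟨k, rfl | rfl⟩
  · exact h (2 * t) (2 * t') s s' (by lia) ht (by lia) (by lia) ht' (by lia) (by linarith)
      (by linarith) (by linarith) (by linarith) (by rw [legendreSym.mul, he, ← legendreSym.mul])
  · have hp : Odd p := (Fact.out : p.Prime).odd_of_ne_two (by rintro rfl; lia)
    obtain ⟨m, hm⟩ := hp
    have key : ∀ w : ℤ, legendreSym p (p - 2 * w) = legendreSym p (-2) * legendreSym p w := by
      intro w
      rw [← legendreSym.mul, legendreSym.mod p (p - 2 * w), legendreSym.mod p (-2 * w)]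
      have e : (p : ℤ) - 2 * w = -2 * w + p * 1 := by ring
      rw [e, Int.add_mul_emod_self_left]
    have := h (p - 2 * t) (p - 2 * t') (A - 1 - s) (A - 1 - s') (by lia) (by lia) (by lia)
      (by lia) (by lia) (by lia) (by linarith) (by linarith) (by linarith) (by linarith)
      (by rw [key, key, he])
    lia

theorem FloorCompat.false_of_two (h : FloorCompat p 2 A i) (hp : 81 < (p : ℤ)) (hA2 : 2 ≤ A)
    (hA : 2 * A < p) : False := by
  have hone : legendreSym p 1 = 1 := legendreSym.at_one p
  have hodd : ∀ t s : ℤ, 0 < t → 2 * t < p → s * p < 2 * A * t → 2 * A * t < (s + 1) * p →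
      s % 2 = 1 → legendreSym p t = -1 := by
    intro t s h1 h2 h3 h4 h5
    rcases legendreSym_eq_or h1 (by lia : t < p) with h6 | h6
    · have := h.half t 1 s 0 h1 h2 one_pos (by lia) h3 h4 (by lia) (by lia) (by rw [h6, hone])
      lia
    · exact h6
  obtain ⟨m, hm⟩ : Odd p := (Fact.out : p.Prime).odd_of_ne_two (by rintro rfl; lia)
  set q : ℤ := p / (2 * A) + 1 with hq
  have hq1 : p < 2 * A * q := by
    rw [mul_comm]; exact Int.lt_ediv_add_one_mul_self _ (by lia)
  have hq2 : 2 * A * (q - 1) ≤ p := by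
    rw [hq, add_sub_cancel_right, mul_comm]; exact Int.ediv_mul_le _ (by lia)
  have hq2 : 2 * A * (q - 1) < p := lt_of_le_of_ne hq2 fun e => by
    rw [mul_assoc] at e; lia
  clear_value q
  have hqpos : 2 ≤ q := by by_contra! hlt; nlinarith
  have hq4 : 4 * (q - 1) < p := by nlinarith
  have hχq := hodd q 1 (by lia) (by lia) (by lia) (by lia) rfl
  have heven : ∀ t s : ℤ, 0 < t → 2 * t < p → s * p < 2 * A * t → 2 * A * t < (s + 1) * p →
      s % 2 = 0 → legendreSym p t = 1 := by
    intro t s h1 h2 h3 h4 h5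
    rcases legendreSym_eq_or h1 (by lia : t < p) with h6 | h6
    · exact h6
    · have := h.half t q s 1 h1 h2 (by lia) (by lia) h3 h4 (by lia) (by lia) (by rw [h6, hχq])
      lia
  have hmul : ∀ w : ℤ, legendreSym p (2 * w) = legendreSym p 2 * legendreSym p w :=
    fun w => legendreSym.mul p 2 w
  rcases eq_or_lt_of_le hqpos with rfl | hq3
  · have h4 : legendreSym p 4 = 1 := by
      rw [show (4 : ℤ) = 2 * 2 by norm_num, hmul, hχq]; norm_num
    have hA8 : 8 * A < 3 * p := by
      by_contra! hle
      have := hodd 4 3 (by lia) (by lia) (by lia) (by lia) rfl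
      lia
    have h6 : legendreSym p 6 = -legendreSym p 3 := by
      rw [show (6 : ℤ) = 2 * 3 by norm_num, hmul, hχq]; ring
    have hne : 3 * A ≠ p := fun e =>
      not_dvd_mul_of_lt (p := p) (by lia : (0 : ℤ) < 3) (by lia) (by lia : 0 < A) (by lia)
        ⟨1, by rw [e, mul_one]⟩
    rcases lt_or_gt_of_ne hne with hlt | hgt
    · have h3 := hodd 3 1 (by lia) (by lia) (by lia) (by lia) rfl
      have := hodd 6 3 (by lia) (by lia) (by lia) (by lia) rfl
      lia
    · have h3 := heven 3 2 (by lia) (by lia) (by lia) (by lia) rfl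
      have := heven 6 4 (by lia) (by lia) (by lia) (by lia) rfl
      lia
  · have hsmall : ∀ t : ℤ, 0 < t → t ≤ q - 1 → legendreSym p t = 1 := fun t h1 h2 =>
      heven t 0 h1 (by lia) (by rw [zero_mul]; exact mul_pos (by lia) h1) (by nlinarith) rfl
    have hχ2 := hsmall 2 (by lia) (by lia)
    rcases Int.even_or_odd' q with ⟨k, hk | hk⟩
    · have h1 := hsmall k (by lia) (by lia)
      have h2 := hmul k
      rw [← hk, hχq, hχ2, h1] at h2
      norm_num at h2
    · have h1 := hsmall (k + 1) (by lia) (by lia)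
      have h2 := hmul (k + 1)
      have h3 := hodd (q + 1) 1 (by lia) (by lia) (by lia) (by nlinarith) rfl
      rw [show 2 * (k + 1) = q + 1 by lia, h3, hχ2, h1] at h2
      norm_num at h2

theorem floorCompat_of_image_subset {p n i j : ℕ} [Fact p.Prime] {A : ℤ} (hp2 : p ≠ 2)
    (hn : 0 < n) (hnp : n < p) (hi : i < n)
    (h : (Iclass p n i).image (fmap p A ((p + 1) / 2)) ⊆ Iclass p n j) :
    FloorCompat p n A i := by
  have hodd : p % 2 = 1 := Nat.odd_iff.mp ((Fact.out : p.Prime).odd_of_ne_two hp2)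
  have hval : ∀ x : ℤ, 0 < x → x < p → (n : ℤ) ∣ x - i → ∃ y k : ℤ, 0 < y ∧ y < p ∧
      (n : ℤ) ∣ y - j ∧ y = legendreSym p x * (A * x) + p * k := by
    intro x hx0 hxp hxi
    lift x to ℕ using hx0.le
    have hmem : x ∈ Iclass p n i := by
      rw [Iclass, Finset.mem_filter, Finset.mem_Icc]
      refine ⟨by lia, ?_⟩
      have := (Nat.modEq_iff_dvd.mpr hxi : i ≡ x [MOD n])
      rw [← this, Nat.mod_eq_of_lt hi]
    have hy := h (Finset.mem_image_of_mem _ hmem)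
    rw [Iclass, Finset.mem_filter, Finset.mem_Icc] at hy
    obtain ⟨⟨hy1, hy2⟩, hy3⟩ := hy
    have hcast : ((fmap p A ((p + 1) / 2) x : ℤ) : ZMod p)
        = ((legendreSym p x * (A * x) : ℤ) : ZMod p) := by
      push_cast
      rw [legendreSym.eq_pow, fmap, ZMod.natCast_zmod_val, show (p + 1) / 2 = p / 2 + 1 by lia]
      push_cast
      ring
    obtain ⟨k, hk⟩ := (ZMod.intCast_eq_intCast_iff_dvd_sub _ _ _).mp hcast.symm
    refine ⟨fmap p A ((p + 1) / 2) x, k, by lia, by lia, ?_, by linarith⟩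
    exact Nat.modEq_iff_dvd.mp (by rw [Nat.ModEq, hy3, ← hy3, Nat.mod_mod])
  intro x x' s s' hx0 hx hxi hx0' hx' hxi' h1 h2 h3 h4 he
  obtain ⟨y, k, hy0, hy, hyj, hyk⟩ := hval x hx0 hx hxi
  obtain ⟨y', k', hy0', hy', hyj', hyk'⟩ := hval x' hx0' hx' hxi'
  have hp0 : (0 : ℤ) < p := by lia
  have hcop : IsCoprime (n : ℤ) p := by
    rw [Nat.isCoprime_iff_coprime]
    exact (Nat.coprime_of_lt_prime hn.ne' hnp Fact.out).symm
  have hyy : (n : ℤ) ∣ y - y' := by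
    have := dvd_sub hyj hyj'
    rwa [sub_sub_sub_cancel_right] at this
  have hxx : (n : ℤ) ∣ x - x' := by
    have := dvd_sub hxi hxi'
    rwa [sub_sub_sub_cancel_right] at this
  apply hcop.dvd_of_dvd_mul_right
  rw [← he] at hyk'
  rcases legendreSym_eq_or hx0 hx with hχ | hχ <;> rw [hχ] at hyk hyk'
  · have e : k = -s := by
      have : -s - 1 < k := by by_contra! hle; nlinarith
      have : k < -s + 1 := by by_contra! hle; nlinarith
      lia
    have e' : k' = -s' := by
      have : -s' - 1 < k' := by by_contra! hle; nlinarith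
      have : k' < -s' + 1 := by by_contra! hle; nlinarith
      lia
    have : (s - s') * p = A * (x - x') - (y - y') := by rw [hyk, hyk', e, e']; ring
    rw [this]
    exact dvd_sub (hxx.mul_left _) hyy
  · have e : k = s + 1 := by
      have : s < k := by by_contra! hle; nlinarith
      have : k < s + 2 := by by_contra! hle; nlinarith
      lia
    have e' : k' = s' + 1 := by
      have : s' < k' := by by_contra! hle; nlinarith
      have : k' < s' + 2 := by by_contra! hle; nlinarith
      lia
    have : (s - s') * p = (y - y') + A * (x - x') := by rw [hyk, hyk', e, e']; ring
    rw [this]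
    exact dvd_add hyy (hxx.mul_left _)

theorem FloorCompat.false_of_two_le (h : FloorCompat p n A i) (hn : 2 ≤ n)
    (hpn : (4 * n + 1) ^ 2 < (p : ℤ)) (hA2 : 2 ≤ A) (hA : 2 * A < p) : False := by
  rcases eq_or_lt_of_le hn with rfl | hn
  · exact h.false_of_two (by lia) hA2 hA
  · exact h.false_of_three_le hn hpn hA2 hA

end

theorem stmt_3 (p n : ℕ) (A : ℤ) (hp : p.Prime) (hp4 : p % 4 = 1) (hn : 2 ≤ n)
    (hpn : (4 * n + 1) ^ 2 < p) (hA : 2 * |A| < (p : ℤ)) (hA0 : A ≠ 0)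
    (hA1 : A ≠ 1) (hA1' : A ≠ -1) :
    ∀ i j : ℕ, i ≤ n - 1 → j ≤ n - 1 →
      ¬ ((Iclass p n i).image (fmap p A ((p + 1) / 2)) ⊆ Iclass p n j) := by
  intro i j hi _ hsub
  have : Fact p.Prime := ⟨hp⟩
  have h := floorCompat_of_image_subset (by rintro rfl; lia) (by lia) (by nlinarith) (by lia) hsub
  have hpn' : (4 * (n : ℤ) + 1) ^ 2 < p := by exact_mod_cast hpn
  have hn' : (2 : ℤ) ≤ n := by exact_mod_cast hn
  rcases abs_cases A with ⟨e, hs⟩ | ⟨e, hs⟩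
  · exact h.false_of_two_le hn' hpn' (by lia) (by lia)
  · exact h.neg.false_of_two_le hn' hpn' (by lia) (by lia)
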